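/- arXiv:1712.01502 — 4 statements merged into one kernel-verified Lean document; each statement's English description precedes it below -/
import Mathlib

section
/- (Wandering additivity of coding entropy.) In the standing setting, let ℱ = {Y_1, …, Y_L} (L ≥ 2) be a finite family of nonempty subsets of X∖{∞} with M(∪ℱ) < +∞, and suppose Y_1 ∪ Y_2 is a wandering set, i.e., f^n(Y_1 ∪ Y_2) ∩ (Y_1 ∪ Y_2) = ∅ for every integer n ≠ 0. Then h_pol(f; ℱ) = max( h_pol(f; {Y_1, Y_3, …, Y_L}), h_pol(f; {Y_2, Y_3, …, Y_L}) ). -/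
open Filter Topology Set
open scoped ENNReal

/-- `E` is `(n, ε)`-separated for `f`: any two distinct points of `E` are `ε`-apart at some
time `k ∈ {0, …, n-1}`. -/
def IsDynSeparated {X : Type*} [MetricSpace X] (f : X → X) (n : ℕ) (ε : ℝ) (E : Set X) : Prop :=
  ∀ x ∈ E, ∀ y ∈ E, x ≠ y → ∃ k < n, ε < dist (f^[k] x) (f^[k] y)

/-- `S(n, ε)`: the maximal cardinality of an `(n, ε)`-separated set. -/
noncomputable def maxSep {X : Type*} [MetricSpace X] (f : X → X) (n : ℕ) (ε : ℝ) : ℕ :=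
  sSup {m | ∃ E : Finset X, IsDynSeparated f n ε ↑E ∧ E.card = m}

/-- Polynomial entropy `h_pol(f) = lim_{ε → 0} limsup_n (log S(n,ε) / log n)`, a value in
`[0, ∞]`.  Since `ε ↦ limsup_n (log S(n,ε) / log n)` is nonincreasing in `ε`, the limit as
`ε → 0⁺` is the supremum over `ε > 0`. -/
noncomputable def polEntropy {X : Type*} [MetricSpace X] (f : X → X) : ℝ≥0∞ :=
  ⨆ (ε : ℝ) (_ : 0 < ε),
    Filter.atTop.limsup fun n : ℕ =>
      ENNReal.ofReal (Real.log (maxSep f n ε) / Real.log n)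

/-- Topological entropy `h_top(f) = lim_{ε → 0} limsup_n (1/n) log S(n,ε)`. -/
noncomputable def topEntropy {X : Type*} [MetricSpace X] (f : X → X) : ℝ≥0∞ :=
  ⨆ (ε : ℝ) (_ : 0 < ε),
    Filter.atTop.limsup fun n : ℕ =>
      ENNReal.ofReal (Real.log (maxSep f n ε) / n)

/-- The set `A_n(ℱ)` of codings of orbit segments of length `n` relative to the finite
family `ℱ`: words `w` with letters in `ℱ ∪ {∞_ℱ}` (where `∞_ℱ` is the complement of `∪ℱ`)
for which some orbit segment `(x, f x, …, f^{n-1} x)` satisfies `f^k x ∈ w k` for all `k`. -/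
def codings {X : Type*} (f : X → X) (F : Finset (Set X)) (n : ℕ) : Set (Fin n → Set X) :=
  {w | (∀ k, w k ∈ F ∨ w k = (⋃₀ (F : Set (Set X)))ᶜ) ∧
      ∃ x : X, ∀ k : Fin n, f^[(k : ℕ)] x ∈ w k}

/-- Coding polynomial entropy of a finite family: `h_pol(f; ℱ) = limsup_n log #A_n(ℱ) / log n`.
For a single set `Y`, `h_pol(f; Y)` is `codingEntropy f {Y}`. -/
noncomputable def codingEntropy {X : Type*} (f : X → X) (F : Finset (Set X)) : ℝ≥0∞ :=
  Filter.atTop.limsup fun n : ℕ =>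
    ENNReal.ofReal (Real.log ((codings f F n).ncard) / Real.log n)

/-- The `n`-th iterate of a homeomorphism, for `n : ℤ`. -/
def zIter {X : Type*} [TopologicalSpace X] (f : X ≃ₜ X) (n : ℤ) (x : X) : X :=
  (f.toEquiv ^ n) x

/-- A set `Z` is wandering if `f^n(Z) ∩ Z = ∅` for every integer `n ≠ 0`. -/
def IsWanderingSet {X : Type*} [TopologicalSpace X] (f : X ≃ₜ X) (Z : Set X) : Prop :=
  ∀ n : ℤ, n ≠ 0 → zIter f n '' Z ∩ Z = ∅

/-- Standing setting: `p` (the point written `∞` in the paper) is a fixed point of `f`, and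
every other point is wandering, i.e. has a wandering neighborhood. -/
def StandingSetting {X : Type*} [TopologicalSpace X] (f : X ≃ₜ X) (p : X) : Prop :=
  f p = p ∧ ∀ x : X, x ≠ p → ∃ U ∈ 𝓝 x, IsWanderingSet f U

/-- `M(Y) = sup_{x ∈ X} #{n ∈ ℤ : f^n(x) ∈ Y}`. -/
noncomputable def orbitCount {X : Type*} [TopologicalSpace X] (f : X ≃ₜ X) (Y : Set X) : ℕ∞ :=
  ⨆ x : X, {n : ℤ | zIter f n x ∈ Y}.encard

/-- Local polynomial entropy `h^loc_pol(f; S)` of a finite set `S`: the limit, along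
decreasing neighborhood bases of the points of `S`, of the coding entropies of the
corresponding families of neighborhoods.  By monotonicity of the coding entropy this limit
equals the infimum of `h_pol(f; {U x : x ∈ S})` over all families `U` of respective
neighborhoods of the points of `S` such that `M(⋃_{x ∈ S} U x) < ∞` (such families exist,
and any decreasing neighborhood basis eventually consists of such sets). -/
noncomputable def localEntropy {X : Type*} [TopologicalSpace X] (f : X ≃ₜ X)
    (S : Finset X) : ℝ≥0∞ :=
  letI := Classical.decEq (Set X)
  ⨅ (U : X → Set X) (_ : ∀ x ∈ S, U x ∈ 𝓝 x)
    (_ : orbitCount f (⋃ x ∈ S, U x) < ⊤),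
    codingEntropy ⇑f (S.image U)

/-- The family `U` of sets (indexed by the points of `S`) is mutually singular: for every
`M` there are a point `x` and times `(N a)_{a ∈ S}` with `f^{N a}(x) ∈ U a` for all `a ∈ S`
and `|N a - N b| > M` for all `a ≠ b` in `S`. -/
def MutuallySingularFam {X : Type*} [TopologicalSpace X] (f : X ≃ₜ X) (S : Finset X)
    (U : X → Set X) : Prop :=
  ∀ M : ℕ, ∃ (x : X) (N : X → ℤ),
    (∀ a ∈ S, zIter f (N a) x ∈ U a) ∧
    ∀ a ∈ S, ∀ b ∈ S, a ≠ b → (M : ℤ) < |N a - N b|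

/-- A finite set `S` is singular if every family of respective neighborhoods of its points
is mutually singular. -/
def IsSingularSet {X : Type*} [TopologicalSpace X] (f : X ≃ₜ X) (S : Finset X) : Prop :=
  ∀ U : X → Set X, (∀ a ∈ S, U a ∈ 𝓝 a) → MutuallySingularFam f S U

open Classical in
theorem codings_finite {X : Type*} (f : X → X) (F : Finset (Set X)) (n : ℕ) :
    (codings f F n).Finite := by
  refine (Set.Finite.pi' (t := fun _ : Fin n => ((insert (⋃₀ (F : Set (Set X)))ᶜ F :
    Finset (Set X)) : Set (Set X))) fun _ => Finset.finite_toSet _).subset ?_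
  intro w hw k
  have := hw.1 k
  simp only [Finset.coe_insert, Set.mem_insert_iff, Finset.mem_coe]
  tauto

/-- The codings relative to `F'` that use only letters of a subfamily `F` and the complement
of `⋃₀ F'` are at most as numerous as the codings relative to `F`. -/
theorem ncard_codings_restrict_le {X : Type*} (f : X → X) {F F' : Finset (Set X)}
    (hFF : F ⊆ F') {p : X} (hp : ∀ Y ∈ F, p ∉ Y) (n : ℕ) :
    {w ∈ codings f F' n | ∀ k, w k ∈ F ∨ w k = (⋃₀ (F' : Set (Set X)))ᶜ}.ncard ≤
      (codings f F n).ncard := by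
  classical
  have hinf : (⋃₀ (F : Set (Set X)))ᶜ ∉ F := fun h => hp _ h (by
    rintro ⟨Y, hY, hpY⟩
    exact hp Y hY hpY)
  refine Set.ncard_le_ncard_of_injOn
    (fun w k => if w k ∈ F then w k else (⋃₀ (F : Set (Set X)))ᶜ) ?_ ?_ (codings_finite f F n)
  · rintro w ⟨⟨-, x, hx⟩, hwF⟩
    refine ⟨fun k => ?_, x, fun k => ?_⟩
    · by_cases h : w k ∈ F <;> simp [h]
    · by_cases h : w k ∈ F
      · simpa [h] using hx k
      · have hk := hx k
        rw [(hwF k).resolve_left h] at hk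
        simp only [h, if_false]
        exact fun h' => hk (Set.sUnion_subset_sUnion (Finset.coe_subset.2 hFF) h')
  · rintro w ⟨-, hw⟩ v ⟨-, hv⟩ hwv
    funext k
    have hk := congrFun hwv k
    by_cases h : w k ∈ F <;> by_cases h' : v k ∈ F <;> simp only [h, h', if_true, if_false] at hk
    · exact hk
    · exact absurd (hk ▸ h) hinf
    · exact absurd (hk ▸ h') hinf
    · rw [(hw k).resolve_left h, (hv k).resolve_left h']

theorem iterate_eq_zIter {X : Type*} [TopologicalSpace X] (f : X ≃ₜ X) (k : ℕ) (x : X) :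
    f^[k] x = zIter f k x := by
  simp only [zIter, zpow_natCast]
  induction k with
  | zero => rfl
  | succ k ih => rw [Function.iterate_succ_apply', ih, pow_succ']; rfl

/-- In a coding relative to `F`, at most `M(⋃₀ F)` letters belong to `F`. -/
theorem card_letters_le_of_mem_codings {X : Type*} [TopologicalSpace X] [DecidableEq (Set X)]
    (f : X ≃ₜ X) {F : Finset (Set X)} {M : ℕ}
    (hM : orbitCount f (⋃₀ (F : Set (Set X))) ≤ M) {n : ℕ} {w : Fin n → Set X}
    (hw : w ∈ codings f F n) : (Finset.univ.filter fun k => w k ∈ F).card ≤ M := by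
  obtain ⟨-, x, hx⟩ := hw
  have hinj : Function.Injective fun k : Fin n => ((k : ℕ) : ℤ) := fun a b h => by
    simpa [Fin.ext_iff] using h
  have hsub : (fun k : Fin n => ((k : ℕ) : ℤ)) ''
      ((Finset.univ.filter fun k => w k ∈ F : Finset (Fin n)) : Set (Fin n)) ⊆
      {m : ℤ | zIter f m x ∈ ⋃₀ (F : Set (Set X))} := by
    rintro _ ⟨k, hk, rfl⟩
    refine ⟨w k, by simpa using hk, ?_⟩
    rw [← iterate_eq_zIter]
    exact hx k
  have h := (Set.encard_le_encard hsub).trans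
    ((le_iSup (fun x => {m : ℤ | zIter f m x ∈ ⋃₀ (F : Set (Set X))}.encard) x).trans hM)
  rw [hinj.encard_image, Set.encard_coe_eq_coe_finsetCard] at h
  exact_mod_cast h

theorem ncard_codings_le_of_subset {X : Type*} [TopologicalSpace X] (f : X ≃ₜ X)
    {F F' : Finset (Set X)} (hFF : F ⊆ F') {M : ℕ}
    (hM : orbitCount f (⋃₀ (F' : Set (Set X))) ≤ M) (n : ℕ) :
    (codings f F n).ncard ≤ 2 ^ M * (codings f F' n).ncard := by
  classical
  have hfin := codings_finite f F' n
  let words : (Fin n → Set X) → Finset (Fin n → Set X) := fun w' =>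
    (Finset.univ.filter fun k => w' k ∈ F').powerset.image fun S k =>
      if k ∈ S then w' k else (⋃₀ (F : Set (Set X)))ᶜ
  have hsub : codings f F n ⊆ (hfin.toFinset.biUnion words : Finset (Fin n → Set X)) := by
    rintro w ⟨hwF, x, hx⟩
    have hex : ∀ k : Fin n, ∃ l : Set X, (l ∈ F' ∨ l = (⋃₀ (F' : Set (Set X)))ᶜ) ∧
        f^[(k : ℕ)] x ∈ l ∧ (w k ∈ F → l = w k) := by
      intro k
      by_cases h : w k ∈ F
      · exact ⟨w k, Or.inl (hFF h), hx k, fun _ => rfl⟩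
      · by_cases h' : f^[(k : ℕ)] x ∈ ⋃₀ (F' : Set (Set X))
        · obtain ⟨l, hl, hxl⟩ := h'
          exact ⟨l, Or.inl hl, hxl, fun h'' => absurd h'' h⟩
        · exact ⟨_, Or.inr rfl, h', fun h'' => absurd h'' h⟩
    choose w' hw' hxw' heq using hex
    simp only [Finset.coe_biUnion, Set.mem_iUnion]
    refine ⟨w', by simpa using ⟨hw', x, hxw'⟩, ?_⟩
    simp only [words, Finset.mem_coe, Finset.mem_image, Finset.mem_powerset]
    refine ⟨Finset.univ.filter fun k => w k ∈ F, fun k hk => ?_, ?_⟩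
    · simp only [Finset.mem_filter, Finset.mem_univ, true_and] at hk ⊢
      rw [heq k hk]
      exact hFF hk
    · funext k
      by_cases h : w k ∈ F
      · simp [h, heq k h]
      · simpa [h] using ((hwF k).resolve_left h).symm
  calc (codings f F n).ncard
      ≤ (hfin.toFinset.biUnion words).card := by
        rw [← Set.ncard_coe_finset]
        exact Set.ncard_le_ncard hsub (Finset.finite_toSet _)
    _ ≤ hfin.toFinset.card * 2 ^ M := by
        refine Finset.card_biUnion_le_card_mul _ _ _ fun w' hw' => ?_
        refine Finset.card_image_le.trans ?_
        rw [Finset.card_powerset]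
        exact Nat.pow_le_pow_right two_pos
          (card_letters_le_of_mem_codings f hM (by simpa using hw'))
    _ = 2 ^ M * (codings f F' n).ncard := by
        rw [mul_comm, Set.ncard_eq_toFinset_card _ hfin]

/-- The limit superior defining polynomial growth rates is insensitive to constant factors. -/
theorem limsup_log_div_log_le_of_le_mul {a b : ℕ → ℕ} {C : ℕ} (hC : C ≠ 0)
    (hab : ∀ n, a n ≤ C * b n) :
    (atTop.limsup fun n : ℕ => ENNReal.ofReal (Real.log (a n) / Real.log n)) ≤
      atTop.limsup fun n : ℕ => ENNReal.ofReal (Real.log (b n) / Real.log n) := by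
  have hzero : Tendsto (fun n : ℕ => ENNReal.ofReal (Real.log C / Real.log n)) atTop (𝓝 0) := by
    rw [← ENNReal.ofReal_zero]
    exact ENNReal.tendsto_ofReal
      ((Real.tendsto_log_atTop.comp tendsto_natCast_atTop_atTop).const_div_atTop _)
  have hlog : ∀ n, Real.log (a n) ≤ Real.log C + Real.log (b n) := by
    intro n
    rcases Nat.eq_zero_or_pos (a n) with h | h
    · rw [h, Nat.cast_zero, Real.log_zero]
      exact add_nonneg (Real.log_natCast_nonneg _) (Real.log_natCast_nonneg _)
    · have hb : b n ≠ 0 := fun hb => by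
        have := hab n
        simp [hb] at this
        omega
      rw [← Real.log_mul (by exact_mod_cast hC) (by exact_mod_cast hb)]
      exact Real.log_le_log (by exact_mod_cast h) (by exact_mod_cast hab n)
  calc _ ≤ atTop.limsup ((fun n : ℕ => ENNReal.ofReal (Real.log C / Real.log n)) +
        fun n : ℕ => ENNReal.ofReal (Real.log (b n) / Real.log n)) := by
        refine limsup_le_limsup (Eventually.of_forall fun n => ?_)
        refine le_trans (ENNReal.ofReal_le_ofReal ?_) ENNReal.ofReal_add_le
        rw [← add_div]
        exact div_le_div_of_nonneg_right (hlog n) (Real.log_natCast_nonneg _)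
    _ = _ := ENNReal.limsup_add_of_left_tendsto_zero hzero _

theorem limsup_log_div_log_max (a b : ℕ → ℕ) :
    (atTop.limsup fun n : ℕ => ENNReal.ofReal (Real.log (max (a n) (b n) : ℕ) / Real.log n)) ≤
      max (atTop.limsup fun n : ℕ => ENNReal.ofReal (Real.log (a n) / Real.log n))
        (atTop.limsup fun n : ℕ => ENNReal.ofReal (Real.log (b n) / Real.log n)) := by
  rw [← limsup_max]
  refine limsup_le_limsup (Eventually.of_forall fun n => ?_)
  rcases le_total (a n) (b n) with h | h
  · simp only [max_eq_right h, le_max_right]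
  · simp only [max_eq_left h, le_max_left]

theorem codingEntropy_mono {X : Type*} [TopologicalSpace X] (f : X ≃ₜ X)
    {F F' : Finset (Set X)} (hFF : F ⊆ F')
    (hM : orbitCount f (⋃₀ (F' : Set (Set X))) < ⊤) :
    codingEntropy f F ≤ codingEntropy f F' := by
  obtain ⟨M, hM⟩ := ENat.ne_top_iff_exists.1 hM.ne
  exact limsup_log_div_log_le_of_le_mul (pow_ne_zero M two_ne_zero)
    (ncard_codings_le_of_subset f hFF hM.ge)

theorem IsWanderingSet.eq_of_iterate_mem {X : Type*} [TopologicalSpace X] {f : X ≃ₜ X}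
    {Z : Set X} (hZ : IsWanderingSet f Z) {x : X} {j k : ℕ} (hj : f^[j] x ∈ Z)
    (hk : f^[k] x ∈ Z) : j = k := by
  by_contra hne
  have h := hZ ((k : ℤ) - j) (by omega)
  refine Set.eq_empty_iff_forall_notMem.1 h (f^[k] x) ⟨⟨f^[j] x, hj, ?_⟩, hk⟩
  rw [iterate_eq_zIter, iterate_eq_zIter, zIter, zIter, zIter, ← Equiv.Perm.mul_apply,
    ← zpow_add, sub_add_cancel]

theorem ncard_codings_insert_insert_le {X : Type*} [TopologicalSpace X] [DecidableEq (Set X)]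
    (f : X ≃ₜ X) {p : X} {Y₁ Y₂ : Set X} {G : Finset (Set X)}
    (hp : ∀ Y ∈ insert Y₁ (insert Y₂ G), p ∉ Y) (hw : IsWanderingSet f (Y₁ ∪ Y₂)) (n : ℕ) :
    (codings f (insert Y₁ (insert Y₂ G)) n).ncard ≤
      (codings f (insert Y₁ G) n).ncard + (codings f (insert Y₂ G) n).ncard := by
  have h₁ : insert Y₁ G ⊆ insert Y₁ (insert Y₂ G) :=
    Finset.insert_subset_insert _ (Finset.subset_insert _ _)
  have h₂ : insert Y₂ G ⊆ insert Y₁ (insert Y₂ G) := Finset.subset_insert _ _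
  refine le_trans ?_ (Nat.add_le_add
    (ncard_codings_restrict_le f h₁ (fun Y hY => hp Y (h₁ hY)) n)
    (ncard_codings_restrict_le f h₂ (fun Y hY => hp Y (h₂ hY)) n))
  refine le_trans (Set.ncard_le_ncard ?_ ?_) (Set.ncard_union_le _ _)
  · intro w hwc
    by_contra hcon
    simp only [Set.mem_union, Set.mem_ofPred_eq, hwc, true_and, not_or, not_forall] at hcon
    obtain ⟨⟨j, hj, hj'⟩, k, hk, hk'⟩ := hcon
    have hjm := (hwc.1 j).resolve_right hj'
    have hkm := (hwc.1 k).resolve_right hk'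
    simp only [Finset.mem_insert, not_or] at hj hk hjm hkm
    have hj₂ : w j = Y₂ := by tauto
    have hk₁ : w k = Y₁ := by tauto
    obtain ⟨x, hx⟩ := hwc.2
    have hjk : j = k := Fin.ext (hw.eq_of_iterate_mem (x := x)
      (Or.inr (hj₂ ▸ hx j)) (Or.inl (hk₁ ▸ hx k)))
    exact hk.1 (hjk ▸ hj₂)
  · exact ((codings_finite f _ n).subset (Set.sep_subset _ _)).union
      ((codings_finite f _ n).subset (Set.sep_subset _ _))

/-- wandering additivity of coding entropy: if `ℱ = {Y₁, Y₂} ∪ G`,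
`M(∪ℱ) < ∞` and `Y₁ ∪ Y₂` is wandering, then
`h_pol(f; ℱ) = max(h_pol(f; {Y₁} ∪ G), h_pol(f; {Y₂} ∪ G))`. -/
theorem codingEntropy_wandering_additivity {X : Type*} [MetricSpace X] [CompactSpace X]
    [DecidableEq (Set X)]
    (f : X ≃ₜ X) (p : X) (hst : StandingSetting f p)
    (Y₁ Y₂ : Set X) (G : Finset (Set X))
    (hF : ∀ Y ∈ insert Y₁ (insert Y₂ G), Y.Nonempty ∧ p ∉ Y)
    (hM : orbitCount f (⋃₀ ((insert Y₁ (insert Y₂ G) : Finset (Set X)) : Set (Set X))) < ⊤)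
    (hw : IsWanderingSet f (Y₁ ∪ Y₂)) :
    codingEntropy ⇑f (insert Y₁ (insert Y₂ G)) =
      max (codingEntropy ⇑f (insert Y₁ G)) (codingEntropy ⇑f (insert Y₂ G)) := by
  refine le_antisymm ?_ (max_le ?_ ?_)
  · refine le_trans (limsup_log_div_log_le_of_le_mul (C := 2) two_ne_zero fun n => ?_)
      (limsup_log_div_log_max (fun n => (codings f (insert Y₁ G) n).ncard)
        fun n => (codings f (insert Y₂ G) n).ncard)
    have := ncard_codings_insert_insert_le f (fun Y hY => (hF Y hY).2) hw n
    omega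
  · exact codingEntropy_mono f
      (Finset.insert_subset_insert _ (Finset.subset_insert _ _)) hM
  · exact codingEntropy_mono f (Finset.subset_insert _ _) hM
end

section
/- In the standing setting, let Y_1, …, Y_L be pairwise disjoint nonempty compact wandering subsets of X∖{∞} (a set Z is wandering if f^n(Z) ∩ Z = ∅ for every integer n ≠ 0). Then for every η > 0 there exist nonempty compact sets Y'_1 ⊆ Y_1, …, Y'_L ⊆ Y_L, each of diameter less than η, such that h_pol(f; {Y'_1, …, Y'_L}) = h_pol(f; {Y_1, …, Y_L}). -/
open Filter Topology Set
open scoped ENNReal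

/-- The visit pattern of the orbit segment `(x, …, f^{n-1} x)`: which of the sets `Z i` contain
`f^k x`, for each time `k < n`. -/
def visitPattern {X ι : Type*} (f : X → X) (Z : ι → Set X) (n : ℕ) (x : X) : Fin n → ι → Prop :=
  fun k i => f^[(k : ℕ)] x ∈ Z i

/-- For pairwise disjoint sets, codings of length `n` are counted by visit patterns. -/
theorem ncard_codings_eq_ncard_visitPattern {X ι : Type*} [Fintype ι] [DecidableEq (Set X)]
    (f : X → X) (Z : ι → Set X) (hdisj : ∀ i j, i ≠ j → Disjoint (Z i) (Z j)) (n : ℕ) :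
    (codings f (Finset.univ.image Z) n).ncard = (range (visitPattern f Z n)).ncard := by
  have hmem : ∀ i y, y ∈ Z i → {y' | ∀ j, y' ∈ Z j ↔ y ∈ Z j} = Z i := by
    intro i y hy
    ext y'
    refine ⟨fun h => (h i).2 hy, fun h j => ?_⟩
    by_cases hij : j = i
    · subst hij
      exact iff_of_true h hy
    · have hd := Set.disjoint_left.1 (hdisj i j (Ne.symm hij))
      exact iff_of_false (hd h) (hd hy)
  have hnot : ∀ y, (∀ i, y ∉ Z i) →
      {y' | ∀ j, y' ∈ Z j ↔ y ∈ Z j} =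
        (⋃₀ ((Finset.univ.image Z : Finset (Set X)) : Set (Set X)))ᶜ := by
    intro y hy
    ext y'
    simp [hy]
  let word : (Fin n → ι → Prop) → Fin n → Set X := fun P k => {y | ∀ i, y ∈ Z i ↔ P k i}
  have himage : codings f (Finset.univ.image Z) n = word '' range (visitPattern f Z n) := by
    ext w
    constructor
    · rintro ⟨hw, x, hx⟩
      refine ⟨_, ⟨x, rfl⟩, funext fun k => ?_⟩
      change {y' | ∀ j, y' ∈ Z j ↔ f^[(k : ℕ)] x ∈ Z j} = w k
      rcases hw k with h | h
      · obtain ⟨i, -, hi⟩ := Finset.mem_image.1 h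
        rw [← hi]
        exact hmem i _ (hi ▸ hx k)
      · rw [h]
        refine hnot _ fun i hi => ?_
        have hxk := hx k
        rw [h] at hxk
        exact hxk ⟨Z i, by simp, hi⟩
    · rintro ⟨_, ⟨x, rfl⟩, rfl⟩
      refine ⟨fun k => ?_, x, fun k i => Iff.rfl⟩
      by_cases h : ∃ i, f^[(k : ℕ)] x ∈ Z i
      · obtain ⟨i, hi⟩ := h
        left
        rw [Finset.mem_image]
        exact ⟨i, Finset.mem_univ i, (hmem i _ hi).symm⟩
      · exact Or.inr (hnot _ (not_exists.1 h))
  rw [himage]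
  refine Set.InjOn.ncard_image ?_
  rintro _ ⟨x, rfl⟩ _ ⟨x', rfl⟩ h
  funext k i
  have hx : f^[(k : ℕ)] x ∈ word (visitPattern f Z n x) k := fun i => Iff.rfl
  rw [h] at hx
  exact propext (hx i)

/-- An orbit visits a wandering set at most once. -/
theorem IsWanderingSet.iterate_unique {X : Type*} [TopologicalSpace X] {f : X ≃ₜ X} {Z : Set X}
    (hZ : IsWanderingSet f Z) {x : X} {k l : ℕ} (hk : f^[k] x ∈ Z) (hl : f^[l] x ∈ Z) :
    k = l := by
  by_contra hkl
  have hz : zIter f ((l : ℤ) - k) (f^[k] x) = f^[l] x := by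
    have hiter : ∀ m : ℕ, f^[m] x = (f.toEquiv ^ (m : ℤ)) x := fun m => by
      rw [zpow_natCast]
      exact congrFun (Equiv.Perm.iterate_eq_pow f.toEquiv m) x
    rw [zIter, hiter, hiter, ← Equiv.Perm.mul_apply, ← zpow_add, sub_add_cancel]
  have hmem : f^[l] x ∈ zIter f ((l : ℤ) - k) '' Z ∩ Z := ⟨⟨_, hk, hz⟩, hl⟩
  rw [hZ _ (by omega)] at hmem
  exact hmem

/-- Passing to subsets of wandering sets multiplies the number of visit patterns by at most a
constant. -/
theorem ncard_visitPattern_le_of_subset {X ι : Type*} [Finite ι] [TopologicalSpace X]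
    (f : X ≃ₜ X) {Y Z : ι → Set X} (hY : ∀ i, IsWanderingSet f (Y i)) (hZY : ∀ i, Z i ⊆ Y i)
    (n : ℕ) :
    (range (visitPattern f Z n)).ncard ≤
      Nat.card (ι → Prop) * (range (visitPattern f Y n)).ncard := by
  have hsub : range (visitPattern f Z n) ⊆
      (fun q : (ι → Prop) × (Fin n → ι → Prop) => fun k i => q.2 k i ∧ q.1 i) ''
        (univ ×ˢ range (visitPattern f Y n)) := by
    rintro _ ⟨x, rfl⟩
    refine ⟨(fun i => ∃ k : Fin n, f^[(k : ℕ)] x ∈ Z i, visitPattern f Y n x),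
      ⟨mem_univ _, x, rfl⟩, ?_⟩
    funext k i
    refine propext ⟨?_, fun h => ⟨hZY i h, k, h⟩⟩
    rintro ⟨hk, l, hl⟩
    have hkl : (k : ℕ) = l := (hY i).iterate_unique hk (hZY i hl)
    change f^[(k : ℕ)] x ∈ Z i
    rwa [hkl]
  calc (range (visitPattern f Z n)).ncard ≤ _ := ncard_le_ncard hsub (toFinite _)
    _ ≤ _ := ncard_image_le (toFinite _)
    _ = _ := by rw [ncard_prod, ncard_univ]

/-- If wandering sets `Y i` are covered by sets `Z i a`, `a ∈ t i`, then every visit pattern for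
`Y` is a visit pattern for some choice of pieces. -/
theorem range_visitPattern_subset_iUnion {X ι α : Type*} [Fintype ι] [DecidableEq ι]
    [TopologicalSpace X] (f : X ≃ₜ X) {Y : ι → Set X} (hY : ∀ i, IsWanderingSet f (Y i))
    (t : ι → Finset α) (ht : ∀ i, (t i).Nonempty) (Z : ι → α → Set X)
    (hZY : ∀ i a, Z i a ⊆ Y i) (hcover : ∀ i, ∀ y ∈ Y i, ∃ a ∈ t i, y ∈ Z i a) (n : ℕ) :
    range (visitPattern f Y n) ⊆
      ⋃ c ∈ Fintype.piFinset t, range (visitPattern f (fun i => Z i (c i)) n) := by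
  rintro _ ⟨x, rfl⟩
  have hchoice : ∀ i, ∃ a ∈ t i, ∀ k : Fin n, f^[(k : ℕ)] x ∈ Y i → f^[(k : ℕ)] x ∈ Z i a := by
    intro i
    by_cases h : ∃ k : Fin n, f^[(k : ℕ)] x ∈ Y i
    · obtain ⟨k, hk⟩ := h
      obtain ⟨a, hat, ha⟩ := hcover i _ hk
      refine ⟨a, hat, fun l hl => ?_⟩
      have hlk : (l : ℕ) = k := (hY i).iterate_unique hl hk
      rwa [hlk]
    · obtain ⟨a, hat⟩ := ht i
      exact ⟨a, hat, fun k hk => (h ⟨k, hk⟩).elim⟩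
  choose c hct hc using hchoice
  refine mem_biUnion (Fintype.mem_piFinset.2 hct) ⟨x, ?_⟩
  funext k i
  exact propext ⟨fun h => hZY i _ h, hc i k⟩

/-- Polynomial growth rates: a constant factor is negligible, and a pointwise domination by a
finite family passes to the supremum of the rates. -/
theorem limsup_log_div_log_le_sup {ι : Type*} {s : Finset ι} {N : ℕ → ℕ} {M : ι → ℕ → ℕ} (C : ℕ)
    (h : ∀ n, ∃ i ∈ s, N n ≤ C * M i n) :
    atTop.limsup (fun n : ℕ => ENNReal.ofReal (Real.log (N n) / Real.log n)) ≤
      s.sup fun i => atTop.limsup fun n : ℕ =>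
        ENNReal.ofReal (Real.log (M i n) / Real.log n) := by
  have hzero : Tendsto (fun n : ℕ => ENNReal.ofReal (Real.log C / Real.log n)) atTop (𝓝 0) := by
    have := (Real.tendsto_log_atTop.comp tendsto_natCast_atTop_atTop).const_div_atTop (Real.log C)
    simpa using ENNReal.tendsto_ofReal this
  rw [← limsup_finset_sup,
    ← ENNReal.limsup_add_of_left_tendsto_zero hzero (fun n => s.sup fun i => _)]
  refine limsup_le_limsup (Eventually.of_forall fun n => ?_)
  obtain ⟨i, hi, hle⟩ := h n
  have hterm : ENNReal.ofReal (Real.log (N n) / Real.log n) ≤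
      ENNReal.ofReal (Real.log C / Real.log n) +
        ENNReal.ofReal (Real.log (M i n) / Real.log n) := by
    rcases Nat.eq_zero_or_pos (N n) with h0 | hpos
    · simp [h0]
    · have hCM : C * M i n ≠ 0 := by omega
      have hC : (C : ℝ) ≠ 0 := Nat.cast_ne_zero.2 (left_ne_zero_of_mul hCM)
      have hM : (M i n : ℝ) ≠ 0 := Nat.cast_ne_zero.2 (right_ne_zero_of_mul hCM)
      refine le_trans (ENNReal.ofReal_le_ofReal ?_) ENNReal.ofReal_add_le
      rw [← add_div, ← Real.log_mul hC hM]
      refine div_le_div_of_nonneg_right ?_ (Real.log_natCast_nonneg n)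
      exact Real.log_le_log (by exact_mod_cast hpos) (by exact_mod_cast hle)
  exact hterm.trans (add_le_add le_rfl (Finset.le_sup
    (f := fun i => ENNReal.ofReal (Real.log (M i n) / Real.log n)) hi))

/-- shrinking pairwise disjoint compact wandering sets to pieces of diameter
less than `η` without changing the coding entropy. -/
theorem codingEntropy_shrink_wandering {X : Type*} [MetricSpace X] [CompactSpace X]
    [DecidableEq (Set X)]
    (f : X ≃ₜ X) (p : X) (hst : StandingSetting f p)
    (L : ℕ) (Y : Fin L → Set X)
    (hY : ∀ i, (Y i).Nonempty ∧ IsCompact (Y i) ∧ p ∉ Y i ∧ IsWanderingSet f (Y i))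
    (hdisj : ∀ i j, i ≠ j → Disjoint (Y i) (Y j))
    (η : ℝ) (hη : 0 < η) :
    ∃ Y' : Fin L → Set X,
      (∀ i, Y' i ⊆ Y i ∧ (Y' i).Nonempty ∧ IsCompact (Y' i) ∧ Metric.diam (Y' i) < η) ∧
      codingEntropy ⇑f (Finset.univ.image Y') = codingEntropy ⇑f (Finset.univ.image Y) := by
  have hcov : ∀ i, ∃ t : Finset X, (∀ a ∈ t, a ∈ Y i) ∧
      Y i ⊆ ⋃ a ∈ t, Metric.closedBall a (η / 3) := fun i =>
    (hY i).2.1.elim_nhds_subcover _ fun a _ => Metric.closedBall_mem_nhds a (by positivity)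
  choose t htY htcov using hcov
  let Z : Fin L → X → Set X := fun i a => Y i ∩ Metric.closedBall a (η / 3)
  have hcover : ∀ i, ∀ y ∈ Y i, ∃ a ∈ t i, y ∈ Z i a := by
    intro i y hy
    obtain ⟨a, hat, ha⟩ := mem_iUnion₂.1 (htcov i hy)
    exact ⟨a, hat, hy, ha⟩
  have htne : ∀ i, (t i).Nonempty := by
    intro i
    obtain ⟨y, hy⟩ := (hY i).1
    obtain ⟨a, hat, -⟩ := hcover i y hy
    exact ⟨a, hat⟩
  have hZY : ∀ i a, Z i a ⊆ Y i := fun i a => inter_subset_left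
  have hwand : ∀ i, IsWanderingSet f (Y i) := fun i => (hY i).2.2.2
  have hZdisj : ∀ c : Fin L → X, ∀ i j, i ≠ j → Disjoint (Z i (c i)) (Z j (c j)) :=
    fun c i j hij => (hdisj i j hij).mono (hZY i _) (hZY j _)
  have hsne : (Fintype.piFinset t).Nonempty := Fintype.piFinset_nonempty.2 htne
  have hupper : codingEntropy ⇑f (Finset.univ.image Y) ≤ (Fintype.piFinset t).sup fun c =>
      codingEntropy ⇑f (Finset.univ.image fun i => Z i (c i)) := by
    refine limsup_log_div_log_le_sup (Fintype.piFinset t).card fun n => ?_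
    simp only [ncard_codings_eq_ncard_visitPattern _ _ hdisj,
      ncard_codings_eq_ncard_visitPattern _ _ (hZdisj _)]
    obtain ⟨c, hc, hmax⟩ := Finset.exists_max_image _
      (fun c : Fin L → X => (range (visitPattern f (fun i => Z i (c i)) n)).ncard) hsne
    refine ⟨c, hc, ?_⟩
    calc _ ≤ _ := ncard_le_ncard
          (range_visitPattern_subset_iUnion f hwand t htne Z hZY hcover n) (toFinite _)
      _ ≤ _ := Finset.set_ncard_biUnion_le _ _
      _ ≤ _ := Finset.sum_le_card_nsmul _ _ _ hmax
      _ = _ := smul_eq_mul _ _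
  obtain ⟨c, hc, hsup⟩ := Finset.exists_mem_eq_sup _ hsne fun c : Fin L → X =>
    codingEntropy ⇑f (Finset.univ.image fun i => Z i (c i))
  rw [Fintype.mem_piFinset] at hc
  refine ⟨fun i => Z i (c i), fun i => ⟨hZY i _, ?_, ?_, ?_⟩, le_antisymm ?_ (hsup ▸ hupper)⟩
  · exact ⟨c i, htY i _ (hc i), Metric.mem_closedBall_self (by positivity)⟩
  · exact (hY i).2.1.inter_right Metric.isClosed_closedBall
  · have hdiam : Metric.diam (Z i (c i)) ≤ 2 * (η / 3) :=
      (Metric.diam_mono inter_subset_right Metric.isBounded_closedBall).trans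
        (Metric.diam_closedBall (by positivity))
    linarith
  · have hlower := limsup_log_div_log_le_sup (s := Finset.univ)
      (N := fun n => (codings f (Finset.univ.image fun i => Z i (c i)) n).ncard)
      (M := fun (_ : Unit) n => (codings f (Finset.univ.image Y) n).ncard)
      (Nat.card (Fin L → Prop)) fun n => by
        simp only [ncard_codings_eq_ncard_visitPattern _ _ hdisj,
          ncard_codings_eq_ncard_visitPattern _ _ (hZdisj _)]
        exact ⟨(), Finset.mem_univ _,
          ncard_visitPattern_le_of_subset f hwand (fun i => hZY i (c i)) n⟩
    simpa [codingEntropy] using hlower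
end

section
/- In the standing setting, if Y is a nonempty wandering subset of X∖{∞} (i.e., f^n(Y) ∩ Y = ∅ for all integers n ≠ 0), then h_pol(f; Y) = 1. Consequently, if X ≠ {∞} then h_pol(f) ≥ 1. -/
open Filter Topology Set
open scoped ENNReal

/-- Natural iterates compose additively with integer iterates. -/
theorem iterate_zIter {X : Type*} [TopologicalSpace X] (f : X ≃ₜ X) (k : ℕ) (m : ℤ) (x : X) :
    f^[k] (zIter f m x) = zIter f (k + m) x := by
  have h : (f.toEquiv ^ (k : ℤ) : Equiv.Perm X) (zIter f m x) = zIter f (k + m) x := by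
    simp only [zIter, zpow_add, Equiv.Perm.mul_apply]
  rw [← h, zpow_natCast, ← Equiv.Perm.iterate_eq_pow]
  rfl

theorem IsWanderingSet.zIter_notMem {X : Type*} [TopologicalSpace X] {f : X ≃ₜ X} {Z : Set X}
    (hZ : IsWanderingSet f Z) {n : ℤ} (hn : n ≠ 0) {x : X} (hx : x ∈ Z) : zIter f n x ∉ Z :=
  fun h => (hZ n hn).le ⟨mem_image_of_mem _ hx, h⟩

/-- An orbit visits a wandering set at most once. -/
theorem IsWanderingSet.iterate_mem_unique {X : Type*} [TopologicalSpace X] {f : X ≃ₜ X}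
    {Z : Set X} (hZ : IsWanderingSet f Z) {x : X} {i j : ℕ} (hi : f^[i] x ∈ Z)
    (hj : f^[j] x ∈ Z) : i = j := by
  by_contra hij
  have h0 : ∀ k : ℕ, f^[k] x = zIter f k x := fun k => by
    simpa [zIter] using iterate_zIter f k 0 x
  refine hZ.zIter_notMem (n := (j : ℤ) - i) (by omega) hi ?_
  have h : zIter f ((j : ℤ) - i) (zIter f i x) = zIter f j x := by
    rw [zIter, zIter, ← Equiv.Perm.mul_apply, ← zpow_add, sub_add_cancel, zIter]
  rwa [h0, h, ← h0]

theorem codings_singleton_eq_range {X : Type*} [TopologicalSpace X] {f : X ≃ₜ X} {p : X}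
    (hp : f p = p) {Y : Set X} (hYne : Y.Nonempty) (hYp : p ∉ Y) (hw : IsWanderingSet f Y)
    (n : ℕ) :
    codings f {Y} n = range fun o : Option (Fin n) =>
      o.elim (fun _ => Yᶜ) fun j => Function.update (fun _ => Yᶜ) j Y := by
  ext w
  constructor
  · rintro ⟨hw1, x, hx⟩
    simp only [Finset.mem_singleton, Finset.coe_singleton, sUnion_singleton] at hw1
    by_cases h : ∃ j, w j = Y
    · obtain ⟨j, hj⟩ := h
      refine ⟨some j, funext fun k => ?_⟩
      rcases eq_or_ne k j with rfl | hkj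
      · simp [hj]
      · rcases hw1 k with hk | hk
        · exact absurd (Fin.ext (hw.iterate_mem_unique (hk ▸ hx k) (hj ▸ hx j))) hkj
        · simp [hkj, hk]
    · push Not at h
      exact ⟨none, funext fun k => ((hw1 k).resolve_left (h k)).symm⟩
  · rintro ⟨_ | j, rfl⟩
    · refine ⟨fun k => Or.inr (by simp), p, fun k => ?_⟩
      rw [Function.iterate_fixed hp]
      exact hYp
    · obtain ⟨y, hy⟩ := hYne
      refine ⟨fun k => ?_, zIter f (-j) y, fun k => ?_⟩
      · rcases eq_or_ne k j with rfl | hkj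
        · simp
        · simp [hkj]
      · rw [iterate_zIter]
        rcases eq_or_ne k j with rfl | hkj
        · simpa [zIter] using hy
        · have hkj' : (k : ℕ) ≠ j := fun h => hkj (Fin.ext h)
          simpa [hkj] using hw.zIter_notMem (n := (k : ℤ) + -j) (by omega) hy

theorem ncard_codings_singleton {X : Type*} [TopologicalSpace X] {f : X ≃ₜ X} {p : X}
    (hp : f p = p) {Y : Set X} (hYne : Y.Nonempty) (hYp : p ∉ Y) (hw : IsWanderingSet f Y)
    (n : ℕ) : (codings f {Y} n).ncard = n + 1 := by
  have hne : Y ≠ Yᶜ := fun h => hYp (h.ge hYp)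
  rw [codings_singleton_eq_range hp hYne hYp hw, ← image_univ, ncard_image_of_injective]
  · simp [ncard_univ]
  · rintro (_ | i) (_ | j) h
    · rfl
    · exact absurd (congrFun h j) (by simpa using hne.symm)
    · exact absurd (congrFun h i) (by simpa using hne)
    · rcases eq_or_ne i j with rfl | hij
      · rfl
      · exact absurd (congrFun h i) (by simpa [hij] using hne)

theorem tendsto_log_nat_add_one_div_log :
    Tendsto (fun n : ℕ => Real.log ((n + 1 : ℕ) : ℝ) / Real.log n) atTop (𝓝 1) := by
  have hlog : Tendsto (fun n : ℕ => Real.log n) atTop atTop :=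
    Real.tendsto_log_atTop.comp tendsto_natCast_atTop_atTop
  have h := (Real.tendsto_log_nat_add_one_sub_log.div_atTop hlog).add_const 1
  rw [zero_add] at h
  refine h.congr' ?_
  filter_upwards [hlog.eventually_gt_atTop 0] with n hn
  push_cast
  field_simp
  ring

/-- In a compact space the cardinalities of `(n, ε)`-separated sets are bounded. -/
theorem bddAbove_card_isDynSeparated {X : Type*} [MetricSpace X] [CompactSpace X] {f : X → X}
    (hf : Continuous f) (n : ℕ) {ε : ℝ} (hε : 0 < ε) :
    BddAbove {m | ∃ E : Finset X, IsDynSeparated f n ε ↑E ∧ E.card = m} := by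
  obtain ⟨t, ht⟩ := CompactSpace.elim_nhds_subcover
    (fun x => {y | ∀ k < n, dist (f^[k] y) (f^[k] x) < ε / 2}) fun x =>
      (eventually_all_finite (finite_lt_nat n)).2 fun k _ =>
        (hf.iterate k).continuousAt.eventually (Metric.ball_mem_nhds _ (half_pos hε))
  have hcov : ∀ y, ∃ x ∈ t, ∀ k < n, dist (f^[k] y) (f^[k] x) < ε / 2 := fun y => by
    simpa using ht.ge (mem_univ y)
  choose g hgt hg using hcov
  refine ⟨t.card, ?_⟩
  rintro _ ⟨E, hE, rfl⟩
  refine Finset.card_le_card_of_injOn g (fun y _ => hgt y) fun x hx y hy hxy => ?_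
  by_contra hne
  obtain ⟨k, hk, hlt⟩ := hE x hx y hy hne
  have h1 := hg x k hk
  have h2 := hg y k hk
  rw [← hxy] at h2
  linarith [dist_triangle_right (f^[k] x) (f^[k] y) (f^[k] (g x))]

theorem IsWanderingSet.le_maxSep {X : Type*} [MetricSpace X] [CompactSpace X] {f : X ≃ₜ X}
    {U : Set X} (hU : IsWanderingSet f U) {x : X} {δ ε : ℝ} (hball : Metric.ball x δ ⊆ U)
    (hε : 0 < ε) (hεδ : ε < δ) (n : ℕ) : n ≤ maxSep f n ε := by
  have hxU : x ∈ U := hball (Metric.mem_ball_self (hε.trans hεδ))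
  have key : ∀ i j : ℕ, i ≠ j →
      ε < dist (f^[i] (zIter f (-i) x)) (f^[i] (zIter f (-j) x)) := fun i j hij => by
    have h : zIter f (i + -j) x ∉ Metric.ball x δ := fun hmem =>
      hU.zIter_notMem (by omega) hxU (hball hmem)
    rw [Metric.mem_ball, not_lt, dist_comm] at h
    rw [iterate_zIter, iterate_zIter, add_neg_cancel]
    exact hεδ.trans_le h
  have hinj : Function.Injective fun i : ℕ => zIter f (-i) x := fun i j h => by
    by_contra hij
    have hlt := key i j hij
    simp only at h
    rw [h, dist_self] at hlt
    exact hlt.not_gt hε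
  refine le_csSup (bddAbove_card_isDynSeparated f.continuous n hε)
    ⟨(Finset.range n).map ⟨_, hinj⟩, ?_, by simp⟩
  intro a ha b hb hab
  simp only [Finset.coe_map, Function.Embedding.coeFn_mk, Finset.coe_range, mem_image,
    mem_Iio] at ha hb
  obtain ⟨i, hi, rfl⟩ := ha
  obtain ⟨j, -, rfl⟩ := hb
  exact ⟨i, hi, key i j fun h => hab (by rw [h])⟩

theorem one_le_polEntropy_of_le_maxSep {X : Type*} [MetricSpace X] {f : X → X} {ε : ℝ}
    (hε : 0 < ε) (h : ∀ n, n ≤ maxSep f n ε) : 1 ≤ polEntropy f := by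
  refine le_iSup₂_of_le ε hε (le_limsup_of_frequently_le (Eventually.frequently ?_))
  filter_upwards [eventually_gt_atTop 1] with n hn
  have hn' : (1 : ℝ) < n := by exact_mod_cast hn
  rw [ENNReal.one_le_ofReal, one_le_div (Real.log_pos hn')]
  exact Real.log_le_log (by linarith) (by exact_mod_cast h n)

/-- a nonempty wandering set has coding entropy `1`; consequently, if
`X ≠ {∞}` then `h_pol(f) ≥ 1`. -/
theorem codingEntropy_wandering_eq_one {X : Type*} [MetricSpace X] [CompactSpace X]
    (f : X ≃ₜ X) (p : X) (hst : StandingSetting f p)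
    (Y : Set X) (hYne : Y.Nonempty) (hYp : p ∉ Y) (hw : IsWanderingSet f Y) :
    codingEntropy ⇑f {Y} = 1 ∧ ((∃ x : X, x ≠ p) → 1 ≤ polEntropy ⇑f) := by
  refine ⟨?_, ?_⟩
  · simp only [codingEntropy, ncard_codings_singleton hst.1 hYne hYp hw]
    simpa using (ENNReal.tendsto_ofReal tendsto_log_nat_add_one_div_log).limsup_eq
  · rintro ⟨x, hx⟩
    obtain ⟨U, hUx, hU⟩ := hst.2 x hx
    obtain ⟨δ, hδ, hball⟩ := Metric.mem_nhds_iff.1 hUx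
    exact one_le_polEntropy_of_le_maxSep (half_pos hδ)
      (hU.le_maxSep hball (half_pos hδ) (half_lt_self hδ))
end

section
/- In the standing setting, for every nonempty compact subset Y of X∖{∞} one has M(Y) < +∞, and moreover h_pol(f; Y) ≤ M(Y). -/
open Filter Topology Set
open scoped ENNReal

theorem zIter_sub_zIter {X : Type*} [TopologicalSpace X] (f : X ≃ₜ X) (m n : ℤ) (x : X) :
    zIter f (n - m) (zIter f m x) = zIter f n x := by
  simp only [zIter]
  rw [← Equiv.Perm.mul_apply, ← zpow_add, sub_add_cancel]

theorem zIter_natCast {X : Type*} [TopologicalSpace X] (f : X ≃ₜ X) (n : ℕ) (x : X) :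
    zIter f n x = f^[n] x := by
  simp only [zIter, zpow_natCast]
  induction n generalizing x with
  | zero => rfl
  | succ n ih => rw [pow_succ, Equiv.Perm.mul_apply, ih, Function.iterate_succ_apply]; rfl

/-- An orbit visits a wandering set at most once. -/
theorem IsWanderingSet.eq_of_mem {X : Type*} [TopologicalSpace X] {f : X ≃ₜ X} {U : Set X}
    (hU : IsWanderingSet f U) {x : X} {m n : ℤ} (hm : zIter f m x ∈ U) (hn : zIter f n x ∈ U) :
    m = n := by
  by_contra hne
  have h : zIter f n x ∈ zIter f (n - m) '' U ∩ U :=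
    ⟨⟨zIter f m x, hm, zIter_sub_zIter f m n x⟩, hn⟩
  rw [hU (n - m) (sub_ne_zero.mpr (Ne.symm hne))] at h
  exact h

theorem orbitCount_lt_top_of_isCompact {X : Type*} [TopologicalSpace X] {f : X ≃ₜ X} {Y : Set X}
    (hY : IsCompact Y) (hw : ∀ x ∈ Y, ∃ U ∈ 𝓝 x, IsWanderingSet f U) : orbitCount f Y < ⊤ := by
  choose! U hU hwU using hw
  obtain ⟨t, htY, ht⟩ := hY.elim_nhds_subcover U hU
  refine lt_of_le_of_lt (iSup_le fun x => ?_) (ENat.natCast_lt_top t.card)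
  have hcov : ∀ n ∈ {n : ℤ | zIter f n x ∈ Y}, ∃ i ∈ t, zIter f n x ∈ U i := fun n hn => by
    simpa using ht hn
  have : Nonempty X := ⟨x⟩
  choose! i hit hi using hcov
  rw [← Set.encard_coe_eq_coe_finsetCard]
  refine Set.encard_le_encard_of_injOn (f := i) hit fun m hm n hn hmn => ?_
  exact (hwU _ (htY _ (hit m hm))).eq_of_mem (hi m hm) (hmn ▸ hi n hn)

/-- A finite set with at most `M` elements is listed by a partial function on `Fin M`. -/
theorem Finset.exists_fin_option_of_card_le {α : Type*} (S : Finset α) {M : ℕ} (h : S.card ≤ M) :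
    ∃ g : Fin M → Option α, ∀ a, a ∈ S ↔ ∃ i, g i = some a := by
  refine ⟨fun i => S.toList[(i : ℕ)]?, fun a => ?_⟩
  rw [← Finset.mem_toList, List.mem_iff_getElem?]
  constructor
  · rintro ⟨i, hi⟩
    obtain ⟨hlt, -⟩ := List.getElem?_eq_some_iff.mp hi
    rw [Finset.length_toList] at hlt
    exact ⟨⟨i, hlt.trans_le h⟩, hi⟩
  · rintro ⟨i, hi⟩
    exact ⟨i, hi⟩

theorem ncard_codings_singleton_le {X : Type*} [TopologicalSpace X] (f : X ≃ₜ X) {Y : Set X}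
    {M : ℕ} (hM : orbitCount f Y ≤ M) (n : ℕ) : (codings f {Y} n).ncard ≤ (n + 1) ^ M := by
  classical
  let word : (Fin M → Option (Fin n)) → Fin n → Set X :=
    fun g k => if ∃ i, g i = some k then Y else Yᶜ
  have hsub : codings f {Y} n ⊆ word '' Set.univ := by
    rintro w ⟨hw, x, hx⟩
    have hcard : (Finset.univ.filter fun k : Fin n => f^[(k : ℕ)] x ∈ Y).card ≤ M := by
      rw [← Nat.cast_le (α := ℕ∞), ← Set.encard_coe_eq_coe_finsetCard]
      refine le_trans (Set.encard_le_encard_of_injOn (f := fun k : Fin n => ((k : ℕ) : ℤ))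
        (t := {m : ℤ | zIter f m x ∈ Y}) ?_ ?_)
        ((le_iSup (fun x : X => {m : ℤ | zIter f m x ∈ Y}.encard) x).trans hM)
      · intro k hk
        simpa [zIter_natCast] using hk
      · intro a _ b _ hab
        exact Fin.ext (by simpa using hab)
    obtain ⟨g, hg⟩ := Finset.exists_fin_option_of_card_le _ hcard
    refine ⟨g, Set.mem_univ g, funext fun k => ?_⟩
    have hgk := hg k
    rw [Finset.mem_filter_univ] at hgk
    have hwk : w k = Y ∨ w k = Yᶜ := by simpa using hw k
    have hxk := hx k
    by_cases hk : f^[(k : ℕ)] x ∈ Y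
    · rcases hwk with h | h
      · simp [word, hgk.mp hk, h]
      · rw [h] at hxk
        exact absurd hk hxk
    · rcases hwk with h | h
      · rw [h] at hxk
        exact absurd hxk hk
      · simp only [word, if_neg (mt hgk.mpr hk), h]
  calc (codings f {Y} n).ncard ≤ (word '' Set.univ).ncard :=
        Set.ncard_le_ncard hsub (Set.toFinite _)
    _ ≤ (Set.univ : Set (Fin M → Option (Fin n))).ncard := Set.ncard_image_le (Set.toFinite _)
    _ = (n + 1) ^ M := by simp [Set.ncard_univ]

theorem limsup_log_div_log_le {a : ℕ → ℕ} {M : ℕ} (ha : ∀ n, a n ≤ (n + 1) ^ M) :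
    atTop.limsup (fun n : ℕ => ENNReal.ofReal (Real.log (a n) / Real.log n)) ≤ M := by
  have hlim : Tendsto (fun n : ℕ => ENNReal.ofReal (M * (Real.log 2 / Real.log n + 1)))
      atTop (𝓝 (M : ℝ≥0∞)) := by
    have h0 : Tendsto (fun n : ℕ => Real.log 2 / Real.log n) atTop (𝓝 0) :=
      (Real.tendsto_log_atTop.comp tendsto_natCast_atTop_atTop).const_div_atTop _
    simpa using ENNReal.tendsto_ofReal ((h0.add_const 1).const_mul (M : ℝ))
  rw [← hlim.limsup_eq]
  refine limsup_le_limsup ?_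
  filter_upwards [eventually_ge_atTop 2] with n hn
  refine ENNReal.ofReal_le_ofReal ?_
  have hn2 : (2 : ℝ) ≤ n := by exact_mod_cast hn
  have hlog : 0 < Real.log n := Real.log_pos (by linarith)
  have hsucc : Real.log (n + 1) ≤ Real.log 2 + Real.log n := by
    rw [← Real.log_mul (by norm_num) (by linarith)]
    exact Real.log_le_log (by linarith) (by linarith)
  have hle : Real.log (a n) ≤ M * Real.log (n + 1) := by
    rcases Nat.eq_zero_or_pos (a n) with h | h
    · rw [h, Nat.cast_zero, Real.log_zero]
      exact mul_nonneg (Nat.cast_nonneg M) (Real.log_nonneg (by linarith))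
    · rw [← Real.log_pow]
      exact Real.log_le_log (by exact_mod_cast h) (by exact_mod_cast ha n)
  rw [div_le_iff₀ hlog, mul_assoc, add_mul, div_mul_cancel₀ _ hlog.ne', one_mul]
  exact hle.trans (mul_le_mul_of_nonneg_left hsucc (Nat.cast_nonneg M))

/-- for a nonempty compact `Y ⊆ X ∖ {∞}` one has `M(Y) < ∞` and
`h_pol(f; Y) ≤ M(Y)`. -/
theorem orbitCount_lt_top_and_codingEntropy_le {X : Type*} [MetricSpace X] [CompactSpace X]
    (f : X ≃ₜ X) (p : X) (hst : StandingSetting f p)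
    (Y : Set X) (hYne : Y.Nonempty) (hYc : IsCompact Y) (hYp : p ∉ Y) :
    orbitCount f Y < ⊤ ∧ codingEntropy ⇑f {Y} ≤ (orbitCount f Y : ℝ≥0∞) := by
  have hfin : orbitCount f Y < ⊤ :=
    orbitCount_lt_top_of_isCompact hYc fun x hx => hst.2 x fun h => hYp (h ▸ hx)
  refine ⟨hfin, ?_⟩
  obtain ⟨M, hM⟩ := ENat.ne_top_iff_exists.mp hfin.ne
  rw [← hM, ENat.toENNReal_coe]
  exact limsup_log_div_log_le (ncard_codings_singleton_le f hM.ge)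
end
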